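/- arXiv:0910.2378 — 2 statements merged into one kernel-verified Lean document; each statement's English description precedes it below -/
import Mathlib

section
/- Let X be a tree-graded space and P a piece of X. If x and y are two points of X with d(x, y) ≤ d(x, P), then π_P(x) = π_P(y). Equivalently (contrapositive), if d(x, y) ≤ r and π_P(x) ≠ π_P(y), then d(x, P) ≤ r. -/
open Set Metric

section Core

variable {X : Type*} [MetricSpace X]

/-- A geodesic segment parametrized by the interval `[a, b]`:
an isometric embedding of `[a, b]` into `X`. -/
def IsGeodesicSegment (γ : ℝ → X) (a b : ℝ) : Prop :=
  ∀ s ∈ Set.Icc a b, ∀ t ∈ Set.Icc a b, dist (γ s) (γ t) = |s - t|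

/-- A metric space is geodesic if every two points are joined by a geodesic. -/
def GeodesicSpace (X : Type*) [MetricSpace X] : Prop :=
  ∀ x y : X, ∃ γ : ℝ → X, IsGeodesicSegment γ 0 (dist x y) ∧ γ 0 = x ∧ γ (dist x y) = y

/-- A subset is geodesic if every two of its points are joined by a geodesic of `X`
contained in the subset. -/
def IsGeodesicSubset (S : Set X) : Prop :=
  ∀ x ∈ S, ∀ y ∈ S, ∃ γ : ℝ → X, IsGeodesicSegment γ 0 (dist x y) ∧ γ 0 = x ∧
    γ (dist x y) = y ∧ ∀ t ∈ Set.Icc (0 : ℝ) (dist x y), γ t ∈ S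

/-- A (complete geodesic) metric space is tree-graded with respect to a collection `PX`
of closed geodesic subsets (pieces) covering `X` if every two different pieces meet in
at most one point (T₁) and every simple loop (injective continuous image of a circle)
is contained in one piece (T₂''). -/
structure IsTreeGraded (X : Type*) [MetricSpace X] (PX : Set (Set X)) : Prop where
  nonempty : ∀ P ∈ PX, P.Nonempty
  closed : ∀ P ∈ PX, IsClosed P
  geodesicSub : ∀ P ∈ PX, IsGeodesicSubset P
  covers : ∀ x : X, ∃ P ∈ PX, x ∈ P
  t1 : ∀ P ∈ PX, ∀ Q ∈ PX, P ≠ Q → (P ∩ Q).Subsingleton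
  t2 : ∀ loop : AddCircle (1 : ℝ) → X, Continuous loop → Function.Injective loop →
    ∃ P ∈ PX, Set.range loop ⊆ P

end Core

/-- Two points are joined by an arc in `S` (possibly degenerate to a point). -/
def ArcJoined {X : Type*} [TopologicalSpace X] (S : Set X) (p q : X) : Prop :=
  ∃ (f : ℝ → X) (L : ℝ), 0 ≤ L ∧ Continuous f ∧ Set.InjOn f (Set.Icc 0 L) ∧ f 0 = p ∧ f L = q ∧
    ∀ t ∈ Set.Icc 0 L, f t ∈ S

namespace ArcJoined

variable {X : Type*} [TopologicalSpace X] {S T : Set X} {p q r : X}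

theorem mono (hST : S ⊆ T) : ArcJoined S p q → ArcJoined T p q := by
  rintro ⟨f, L, hL, hc, hi, h0, h1, hS⟩
  exact ⟨f, L, hL, hc, hi, h0, h1, fun t ht => hST (hS t ht)⟩

theorem symm : ArcJoined S p q → ArcJoined S q p := by
  rintro ⟨f, L, hL, hc, hi, h0, h1, hS⟩
  have hmem : ∀ t ∈ Set.Icc 0 L, L - t ∈ Set.Icc 0 L := fun t ht =>
    ⟨by linarith [ht.2], by linarith [ht.1]⟩
  refine ⟨fun t => f (L - t), L, hL, by fun_prop, fun s hs t ht hst => ?_, by simpa using h1,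
    by simpa using h0, fun t ht => hS _ (hmem t ht)⟩
  have := hi (hmem s hs) (hmem t ht) hst
  linarith

theorem trans [T2Space X] : ArcJoined S p q → ArcJoined S q r → ArcJoined S p r := by
  rintro ⟨f, L, hL, hfc, hfi, hf0, hf1, hfS⟩ ⟨g, M, hM, hgc, hgi, hg0, hg1, hgS⟩
  -- `s` is the first time at which `f` meets the image of `g`
  have hcl : IsClosed (f ⁻¹' (g '' Set.Icc 0 M)) :=
    (isCompact_Icc.image hgc).isClosed.preimage hfc
  have hK : IsCompact (Set.Icc 0 L ∩ f ⁻¹' (g '' Set.Icc 0 M)) := isCompact_Icc.inter_right hcl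
  obtain ⟨s, ⟨⟨hs, t, ht, hts⟩, hmin⟩⟩ := hK.exists_isLeast
    ⟨L, ⟨hL, le_rfl⟩, 0, ⟨le_rfl, hM⟩, by rw [hf1, hg0]⟩
  have hfirst : ∀ u ∈ Set.Icc 0 s, ∀ v ∈ Set.Icc 0 M, f u = g v → u = s := fun u hu v hv h =>
    le_antisymm hu.2 (hmin ⟨⟨hu.1, hu.2.trans hs.2⟩, v, hv, h.symm⟩)
  have hfmem : ∀ u ∈ Set.Icc 0 (s + (M - t)), u ≤ s → u ∈ Set.Icc 0 L := fun u hu h =>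
    ⟨hu.1, h.trans hs.2⟩
  have hgmem : ∀ u ∈ Set.Icc 0 (s + (M - t)), ¬ u ≤ s → u - s + t ∈ Set.Icc 0 M := fun u hu h =>
    ⟨by linarith [ht.1], by linarith [hu.2]⟩
  have hcross : ∀ u ∈ Set.Icc 0 (s + (M - t)), u ≤ s → ∀ v ∈ Set.Icc 0 (s + (M - t)), ¬ v ≤ s →
      f u ≠ g (v - s + t) := by
    intro u hu hus v hv hvs h
    have hu' := hfirst u ⟨hu.1, hus⟩ _ (hgmem v hv hvs) h
    rw [hu', ← hts] at h
    have := hgi ht (hgmem v hv hvs) h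
    exact hvs (by linarith)
  refine ⟨fun u => if u ≤ s then f u else g (u - s + t), s + (M - t),
    by linarith [hs.1, ht.2], ?_, ?_, ?_, ?_, ?_⟩
  · refine Continuous.if_le hfc (by fun_prop) continuous_id continuous_const ?_
    rintro u rfl
    simp [hts]
  · intro u hu v hv huv
    dsimp only at huv
    split_ifs at huv with h1 h2 h2
    · exact hfi (hfmem u hu h1) (hfmem v hv h2) huv
    · exact absurd huv (hcross u hu h1 v hv h2)
    · exact absurd huv.symm (hcross v hv h2 u hu h1)
    · have := hgi (hgmem u hu h1) (hgmem v hv h2) huv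
      linarith
  · simp [hs.1, hf0]
  · dsimp only
    split_ifs with h
    · have : t = M := le_antisymm ht.2 (by linarith)
      rw [← hg1, ← this, hts, sub_self, add_zero]
    · rw [← hg1]
      congr 1
      ring
  · intro u hu
    dsimp only
    split_ifs with h
    · exact hfS _ (hfmem u hu h)
    · exact hgS _ (hgmem u hu h)

end ArcJoined

/-- A geodesic segment agrees on its domain with a globally defined continuous map. -/
theorem IsGeodesicSegment.exists_continuous_eqOn {X : Type*} [MetricSpace X] {γ : ℝ → X} {a b : ℝ}
    (hγ : IsGeodesicSegment γ a b) (hab : a ≤ b) :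
    ∃ f : ℝ → X, Continuous f ∧ Set.EqOn f γ (Set.Icc a b) := by
  have hc : ContinuousOn γ (Set.Icc a b) := by
    refine (LipschitzOnWith.of_dist_le_mul (K := 1) fun s hs t ht => ?_).continuousOn
    rw [hγ s hs t ht, Real.dist_eq, NNReal.coe_one, one_mul]
  exact ⟨Set.IccExtend hab ((Set.Icc a b).domRestrict γ), hc.domRestrict.Icc_extend',
    fun t ht => Set.IccExtend_of_mem hab _ ht⟩

theorem IsGeodesicSegment.injOn {X : Type*} [MetricSpace X] {γ : ℝ → X} {a b : ℝ}
    (hγ : IsGeodesicSegment γ a b) : Set.InjOn γ (Set.Icc a b) := by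
  intro s hs t ht hst
  have h := hγ s hs t ht
  rw [hst, dist_self] at h
  exact sub_eq_zero.mp (abs_eq_zero.mp h.symm)

/-- If `q` is at most as far from `x` as the set `P`, then `x` and `q` are joined by an arc
that avoids `P` except possibly at `q`. -/
theorem GeodesicSpace.arcJoined_of_dist_le_infDist {X : Type*} [MetricSpace X]
    (hgeo : GeodesicSpace X) {P : Set X} {x q : X} (h : dist x q ≤ Metric.infDist x P) :
    ArcJoined (Pᶜ ∪ {q}) x q := by
  obtain ⟨γ, hγ, h0, h1⟩ := hgeo x q
  obtain ⟨f, hfc, hf⟩ := hγ.exists_continuous_eqOn dist_nonneg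
  have hl : (0 : ℝ) ∈ Set.Icc 0 (dist x q) := ⟨le_rfl, dist_nonneg⟩
  have hr : dist x q ∈ Set.Icc 0 (dist x q) := ⟨dist_nonneg, le_rfl⟩
  refine ⟨f, dist x q, dist_nonneg, hfc, hγ.injOn.congr hf.symm, (hf hl).trans h0,
    (hf hr).trans h1, fun t ht => ?_⟩
  rw [hf ht]
  by_cases hP : γ t ∈ P
  · have hle := Metric.infDist_le_dist_of_mem (x := x) hP
    have hd := hγ 0 hl t ht
    rw [h0, zero_sub, abs_neg, abs_of_nonneg ht.1] at hd
    have : t = dist x q := le_antisymm ht.2 (by linarith)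
    rw [this, h1]
    exact Or.inr rfl
  · exact Or.inl hP

/-- A continuous map on `[0, L]` that is injective except for taking the same value at both
ends is a simple loop, hence lies in one piece. -/
theorem IsTreeGraded.exists_piece_of_loop {X : Type*} [MetricSpace X] {PX : Set (Set X)}
    (hTG : IsTreeGraded X PX) {g : ℝ → X} {L : ℝ} (hL : 0 < L) (hg : Continuous g)
    (hinj : Set.InjOn g (Set.Ico 0 L)) (hends : g 0 = g L) :
    ∃ Q ∈ PX, ∀ t ∈ Set.Ico 0 L, g t ∈ Q := by
  have hmem : ∀ t ∈ Set.Ico (0 : ℝ) 1, L * t ∈ Set.Ico 0 L := fun t ht =>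
    ⟨mul_nonneg hL.le ht.1, by nlinarith [ht.2]⟩
  have hrep : ∀ z : AddCircle (1 : ℝ), ∃ t ∈ Set.Ico (0 : ℝ) 1, (t : AddCircle (1 : ℝ)) = z := by
    intro z
    obtain ⟨t, ht, rfl⟩ := (AddCircle.coe_image_Ico_eq (1 : ℝ) 0).symm ▸ Set.mem_univ z
    exact ⟨t, by simpa using ht, rfl⟩
  obtain ⟨Q, hQ, hsub⟩ := hTG.t2 (AddCircle.liftIco 1 0 fun t => g (L * t))
    (AddCircle.liftIco_zero_continuous (by simpa using hends) (by fun_prop)) (by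
      intro z w hzw
      obtain ⟨s, hs, rfl⟩ := hrep z
      obtain ⟨t, ht, rfl⟩ := hrep w
      rw [AddCircle.liftIco_zero_coe_apply hs, AddCircle.liftIco_zero_coe_apply ht] at hzw
      rw [mul_left_cancel₀ hL.ne' (hinj (hmem s hs) (hmem t ht) hzw)])
  refine ⟨Q, hQ, fun t ht => hsub ⟨((t / L : ℝ) : AddCircle (1 : ℝ)), ?_⟩⟩
  rw [AddCircle.liftIco_zero_coe_apply ⟨div_nonneg ht.1 hL.le, (div_lt_one hL).mpr ht.2⟩,
    mul_div_cancel₀ _ hL.ne']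

/-- Distinct points of a piece are not joined by an arc meeting the piece only in its ends. -/
theorem IsTreeGraded.eq_of_arcJoined {X : Type*} [MetricSpace X] {PX : Set (Set X)}
    (hTG : IsTreeGraded X PX) {P : Set X} (hP : P ∈ PX) {p q : X} (hp : p ∈ P) (hq : q ∈ P)
    (h : ArcJoined (Pᶜ ∪ {p, q}) p q) : p = q := by
  by_contra hpq
  obtain ⟨f, L, hL, hfc, hfi, hf0, hfL, hfS⟩ := h
  obtain ⟨γ, hγ, hγ0, hγ1, hγP⟩ := hTG.geodesicSub P hP q hq p hp
  have hL' : 0 < L := hL.lt_of_ne (by rintro rfl; exact hpq (hf0.symm.trans hfL))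
  have hd : 0 < dist q p := dist_pos.mpr (Ne.symm hpq)
  set d := dist q p
  obtain ⟨k, hkc, hk⟩ := hγ.exists_continuous_eqOn hd.le
  have hl : (0 : ℝ) ∈ Set.Icc 0 d := ⟨le_rfl, hd.le⟩
  have hr : d ∈ Set.Icc 0 d := ⟨hd.le, le_rfl⟩
  have hk0 : k 0 = q := (hk hl).trans hγ0
  have hkd : k d = p := (hk hr).trans hγ1
  have hki : Set.InjOn k (Set.Icc 0 d) := hγ.injOn.congr hk.symm
  have hkP : ∀ t ∈ Set.Icc 0 d, k t ∈ P := fun t ht => hk ht ▸ hγP t ht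
  have hends : ∀ u ∈ Set.Icc 0 L, f u ∈ P → f u = p ∨ f u = q := fun u hu hu' =>
    (hfS u hu).resolve_left fun hn => hn hu'
  have hgmem : ∀ v ∈ Set.Ico 0 (L + d), ¬ v ≤ L → v - L ∈ Set.Icc 0 d := fun v hv hvL =>
    ⟨by linarith, by linarith [hv.2]⟩
  have hcross : ∀ u ∈ Set.Icc 0 L, ∀ v ∈ Set.Ico 0 (L + d), ¬ v ≤ L → f u ≠ k (v - L) := by
    intro u hu v hv hvL huv
    have hm := hgmem v hv hvL
    rcases hends u hu (huv ▸ hkP _ hm) with h | h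
    · have := hki hm hr (huv.symm.trans (h.trans hkd.symm))
      linarith [hv.2]
    · have := hki hm hl (huv.symm.trans (h.trans hk0.symm))
      exact hvL (by linarith)
  obtain ⟨Q, hQ, hgQ⟩ := hTG.exists_piece_of_loop (L := L + d)
    (g := fun u => if u ≤ L then f u else k (u - L)) (by linarith)
    (by
      refine Continuous.if_le hfc (by fun_prop) continuous_id continuous_const ?_
      rintro u rfl
      rw [sub_self, hfL, hk0])
    (by
      intro u hu v hv huv
      dsimp only at huv
      split_ifs at huv with h1 h2 h2
      · exact hfi ⟨hu.1, h1⟩ ⟨hv.1, h2⟩ huv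
      · exact absurd huv (hcross u ⟨hu.1, h1⟩ v hv h2)
      · exact absurd huv.symm (hcross v ⟨hv.1, h2⟩ u hu h1)
      · linarith [hki (hgmem u hu h1) (hgmem v hv h2) huv])
    (by simp [hL, hd, hf0, hkd])
  have hfQ : ∀ t ∈ Set.Icc 0 L, f t ∈ Q := fun t ht => by
    simpa [ht.2] using hgQ t ⟨ht.1, by linarith [ht.2]⟩
  have hL0 : (0 : ℝ) ∈ Set.Icc 0 L := ⟨le_rfl, hL⟩
  have hLL : L ∈ Set.Icc 0 L := ⟨hL, le_rfl⟩
  have hQP : Q = P := by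
    by_contra hne
    exact hpq (hTG.t1 Q hQ P hP hne ⟨hf0 ▸ hfQ 0 hL0, hp⟩ ⟨hfL ▸ hfQ L hLL, hq⟩)
  have hmid : L / 2 ∈ Set.Icc 0 L := ⟨by linarith, by linarith⟩
  rcases hends _ hmid (hQP ▸ hfQ _ hmid) with h | h
  · linarith [hfi hmid hL0 (h.trans hf0.symm)]
  · linarith [hfi hmid hLL (h.trans hfL.symm)]

/-- If `d(x, y) ≤ d(x, P)` then the projections of `x` and `y` to the piece `P`
coincide; equivalently, if `d(x, y) ≤ r` and `π_P x ≠ π_P y` then `d(x, P) ≤ r`. -/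
theorem projection_eq_of_dist_le (X : Type*) [MetricSpace X] [CompleteSpace X]
    (PX : Set (Set X)) (hgeo : GeodesicSpace X) (hTG : IsTreeGraded X PX)
    (P : Set X) (hP : P ∈ PX) (x y px py : X)
    (hpx : px ∈ P) (hpy : py ∈ P)
    (hx : dist x px = Metric.infDist x P) (hy : dist y py = Metric.infDist y P) :
    (dist x y ≤ Metric.infDist x P → px = py) ∧
    (∀ r : ℝ, dist x y ≤ r → px ≠ py → Metric.infDist x P ≤ r) := by
  have key : dist x y ≤ Metric.infDist x P → px = py := by
    intro hxy
    have hy' : Pᶜ ∪ {y} ⊆ Pᶜ ∪ {px, py} := by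
      rintro z (hz | rfl)
      · exact Or.inl hz
      · by_cases hzP : z ∈ P
        · rw [Metric.infDist_zero_of_mem hzP, dist_eq_zero] at hy
          exact Or.inr (Or.inr hy)
        · exact Or.inl hzP
    exact hTG.eq_of_arcJoined hP hpx hpy <|
      ((hgeo.arcJoined_of_dist_le_infDist hx.le).symm.mono
        (Set.union_subset_union_right _ (by simp))).trans <|
      ((hgeo.arcJoined_of_dist_le_infDist hxy).mono hy').trans
        ((hgeo.arcJoined_of_dist_le_infDist hy.le).mono
          (Set.union_subset_union_right _ (by simp)))
  refine ⟨key, fun r hr hne => ?_⟩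
  by_contra! h
  exact hne (key (hr.trans h.le))
end

section
/- Let (X,d) be a metric space, let r > 0 and f(r) ≥ r, let c : X → {0, 1, …, n} be a coloring such that every r-scale connected component of each color class has diameter at most f(r), and let x₀ ∈ X. Define a new coloring c̃ : X → {0, 1, …, n} by c̃(x) = 0 if d(x, x₀) ≤ 2r and c̃(x) = c(x) otherwise. Then every r-scale connected component of each nonzero c̃-color class has diameter at most f(r), and every r-scale connected component of the c̃-color class 0 has diameter at most 8·f(r). -/
section Chains

variable {Y : Type*}

/-- An `r`-chain from `x` to `y` inside the set `S`, with respect to the distance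
function `d`: a finite sequence `x = c 0, c 1, …, c m = y` of points of `S` with
consecutive distances `< r`. -/
def IsDChain (d : Y → Y → ℝ) (r : ℝ) (S : Set Y) (x y : Y) : Prop :=
  ∃ (m : ℕ) (c : ℕ → Y), c 0 = x ∧ c m = y ∧ (∀ i ≤ m, c i ∈ S) ∧
    ∀ i < m, d (c i) (c (i + 1)) < r

/-- A set is `r`-scale connected if every two of its points are joined by an
`r`-chain contained in it. -/
def DScaleConnected (d : Y → Y → ℝ) (r : ℝ) (S : Set Y) : Prop :=
  ∀ x ∈ S, ∀ y ∈ S, IsDChain d r S x y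

/-- `C` is an `r`-scale connected component of `U`: a maximal `r`-scale connected
subset of `U`. -/
def IsDComponent (d : Y → Y → ℝ) (r : ℝ) (U C : Set Y) : Prop :=
  C ⊆ U ∧ DScaleConnected d r C ∧
    ∀ C', C ⊆ C' → C' ⊆ U → DScaleConnected d r C' → C = C'

/-- A set is `M`-bounded: its diameter is at most `M`. -/
def DBounded (d : Y → Y → ℝ) (M : ℝ) (S : Set Y) : Prop :=
  ∀ x ∈ S, ∀ y ∈ S, d x y ≤ M

/-- A space has dimension `≤ n` at scale `s` of magnitude `M` if there is a cover by
`n + 1` sets such that every `s`-scale connected component of each of them is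
`M`-bounded. -/
def DimLeAtScale (d : Y → Y → ℝ) (n : ℕ) (s M : ℝ) : Prop :=
  ∃ U : Fin (n + 1) → Set Y, (∀ y, ∃ i, y ∈ U i) ∧
    ∀ i C, IsDComponent d s (U i) C → DBounded d M C

end Chains
section ChainLemmas

variable {Y : Type*} {d : Y → Y → ℝ} {r : ℝ} {S T : Set Y} {x y z : Y}

theorem IsDChain.refl (hx : x ∈ S) : IsDChain d r S x x :=
  ⟨0, fun _ => x, rfl, rfl, fun _ _ => hx, fun i hi => absurd hi (Nat.not_lt_zero i)⟩

theorem IsDChain.mono (hST : S ⊆ T) (h : IsDChain d r S x y) : IsDChain d r T x y := by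
  obtain ⟨m, c, h0, hm, hS, hd⟩ := h
  exact ⟨m, c, h0, hm, fun i hi => hST (hS i hi), hd⟩

theorem IsDChain.left_mem (h : IsDChain d r S x y) : x ∈ S := by
  obtain ⟨m, c, rfl, -, hS, -⟩ := h
  exact hS 0 (Nat.zero_le m)

theorem IsDChain.right_mem (h : IsDChain d r S x y) : y ∈ S := by
  obtain ⟨m, c, -, rfl, hS, -⟩ := h
  exact hS m le_rfl

theorem IsDChain.tail (h : IsDChain d r S x y) (hz : z ∈ S) (hyz : d y z < r) :
    IsDChain d r S x z := by
  obtain ⟨m, c, h0, hm, hS, hd⟩ := h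
  refine ⟨m + 1, fun i => if i ≤ m then c i else z, by simpa using h0, by simp, ?_, ?_⟩
  · intro i _
    by_cases h : i ≤ m
    · simpa [h] using hS i h
    · simpa [h] using hz
  · intro i hi
    rcases Nat.lt_succ_iff_lt_or_eq.mp hi with h | rfl
    · have h1 : i + 1 ≤ m := h
      simpa [h.le, h1] using hd i h
    · simpa [hm] using hyz

/-- Induction along a chain, adding one point at a time at its end. -/
theorem IsDChain.induction {P : Y → Prop} (h : IsDChain d r S x y) (base : P x)
    (step : ∀ a b, IsDChain d r S x a → b ∈ S → d a b < r → P a → P b) : P y := by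
  obtain ⟨m, c, rfl, rfl, hS, hd⟩ := h
  suffices ∀ i ≤ m, P (c i) from this m le_rfl
  intro i
  induction i with
  | zero => exact fun _ => base
  | succ i ih =>
    intro hi
    exact step (c i) (c (i + 1))
      ⟨i, c, rfl, rfl, fun k hk => hS k (by omega), fun k hk => hd k (by omega)⟩
      (hS _ hi) (hd i hi) (ih (by omega))

theorem IsDChain.trans (hxy : IsDChain d r S x y) (hyz : IsDChain d r S y z) :
    IsDChain d r S x z :=
  hyz.induction (P := fun a => IsDChain d r S x a) hxy fun _ _ _ hb hab h => h.tail hb hab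

theorem IsDChain.symm (hd : ∀ a b, d a b = d b a) (h : IsDChain d r S x y) :
    IsDChain d r S y x :=
  h.induction (P := fun a => IsDChain d r S a x) (.refl h.left_mem) fun a b ha hb hab hax =>
    ((IsDChain.refl hb).tail ha.right_mem (hd a b ▸ hab)).trans hax

/-- The points reachable from `x` by chains in `S` form a component of `S`. -/
theorem isDComponent_setOf_isDChain (hd : ∀ a b, d a b = d b a) (hx : x ∈ S) :
    IsDComponent d r S {y | IsDChain d r S x y} := by
  have key : ∀ y, IsDChain d r S x y → IsDChain d r {y | IsDChain d r S x y} x y := fun y h =>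
    h.induction (P := fun a => IsDChain d r {y | IsDChain d r S x y} x a)
      (.refl (IsDChain.refl hx)) fun _ _ ha hb hab h => h.tail (ha.tail hb hab) hab
  refine ⟨fun y hy => hy.right_mem, fun y hy z hz => ((key y hy).symm hd).trans (key z hz), ?_⟩
  intro C' hC hC' hconn
  exact hC.antisymm fun y hy => (hconn x (hC (IsDChain.refl hx)) y hy).mono hC'

theorem IsDChain.dist_le {M : ℝ} (hd : ∀ a b, d a b = d b a)
    (hS : ∀ C, IsDComponent d r S C → DBounded d M C) (h : IsDChain d r S x y) : d x y ≤ M :=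
  hS _ (isDComponent_setOf_isDChain hd h.left_mem) x (.refl h.left_mem) y h

end ChainLemmas

/-- A chain in `T ⊆ S ∪ closedBall x₀ R` either stays in `S` or starts near `x₀`. -/
theorem IsDChain.isDChain_or_dist_le {X : Type*} [MetricSpace X] {r R M : ℝ} {S T : Set X}
    {x y x₀ : X} (hr : 0 ≤ r) (hM : 0 ≤ M)
    (hS : ∀ C, IsDComponent dist r S C → DBounded dist M C)
    (hT : ∀ a ∈ T, dist a x₀ ≤ R ∨ a ∈ S) (h : IsDChain dist r T x y) :
    IsDChain dist r S x y ∨ dist x x₀ ≤ M + r + R := by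
  refine h.induction (P := fun a => IsDChain dist r S x a ∨ dist x x₀ ≤ M + r + R) ?_ ?_
  · rcases hT x h.left_mem with h | h
    · exact .inr (by linarith)
    · exact .inl (.refl h)
  · rintro a b - hb hab (ha | ha)
    · rcases hT b hb with h | h
      · have := ha.dist_le dist_comm hS
        exact .inr (by linarith [dist_triangle4 x a b x₀])
      · exact .inl (ha.tail h hab)
    · exact .inr ha

/-- Recoloring a `2r`-ball to color `0`: if every `r`-component of each color class of
`c` is `f(r)`-bounded, and `c̃` is obtained from `c` by recoloring the closed ball
`B(x₀, 2r)` with the color `0`, then every `r`-component of each nonzero `c̃`-color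
class is `f(r)`-bounded and every `r`-component of the `c̃`-color class `0` is
`8·f(r)`-bounded. -/
theorem recolor_ball_bound (X : Type*) [MetricSpace X] (n : ℕ) (r fr : ℝ)
    (hr : 0 < r) (hfr : r ≤ fr) (c : X → Fin (n + 1))
    (hc : ∀ (j : Fin (n + 1)) (C : Set X),
      IsDComponent dist r {x : X | c x = j} C → DBounded dist fr C)
    (x₀ : X) (ct : X → Fin (n + 1))
    (hct : ∀ x : X, ct x = if dist x x₀ ≤ 2 * r then 0 else c x) :
    (∀ j : Fin (n + 1), j ≠ 0 → ∀ C : Set X,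
      IsDComponent dist r {x : X | ct x = j} C → DBounded dist fr C) ∧
    (∀ C : Set X,
      IsDComponent dist r {x : X | ct x = 0} C → DBounded dist (8 * fr) C) := by
  constructor
  · intro j hj C hC x hx y hy
    refine ((hC.2.1 x hx y hy).mono fun a ha => ?_).dist_le dist_comm (hc j)
    have ha' : ct a = j := hC.1 ha
    rw [hct] at ha'
    split_ifs at ha' with h
    · exact absurd ha'.symm hj
    · exact ha'
  · intro C hC x hx y hy
    have hT : ∀ a ∈ C, dist a x₀ ≤ 2 * r ∨ a ∈ {x : X | c x = 0} := by
      intro a ha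
      have ha' : ct a = 0 := hC.1 ha
      rw [hct] at ha'
      split_ifs at ha' with h
      · exact .inl h
      · exact .inr ha'
    have hM : 0 ≤ fr := hr.le.trans hfr
    rcases (hC.2.1 x hx y hy).isDChain_or_dist_le hr.le hM (hc 0) hT with h | h
    · linarith [h.dist_le dist_comm (hc 0)]
    rcases (hC.2.1 y hy x hx).isDChain_or_dist_le hr.le hM (hc 0) hT with h' | h'
    · linarith [h'.dist_le dist_comm (hc 0), dist_comm x y]
    · linarith [dist_triangle_right x y x₀]
end
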